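/- For all (z, w, γ, λ) in a dense open subset of ℂ × ℂ × ℂ × ℂ^N, one has the intertwining identity L(z,λ) ∘ (Id ⊗ W^S_n(λ−γh^{(0)})) = (Id ⊗ W^S_n(λ)) ∘ L'(z,λ) as operators on ℂ^N ⊗ (ℂ^N)^{⊗n} (tensor factors numbered 0,1,…,n; the shift λ−γh^{(0)} refers to the weight of the 0-th factor). -/

import Mathlib

open scoped BigOperators
open Complex Matrix Filter Topology

noncomputable section

namespace EllipticQG

/-- Jacobi's first theta function `θ(z) = -∑_{j ∈ ℤ+1/2} e^{πij²τ + 2πij(z+1/2)}`. -/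
def theta (τ z : ℂ) : ℂ :=
  -∑' j : ℤ, Complex.exp ((Real.pi : ℂ) * Complex.I * ((j : ℂ) + 1 / 2) ^ 2 * τ +
      2 * (Real.pi : ℂ) * Complex.I * ((j : ℂ) + 1 / 2) * (z + 1 / 2))

/-- `α(z,μ) = θ(z)θ(μ+γ)/(θ(z-γ)θ(μ))`. -/
def alphaF (τ γ z μ : ℂ) : ℂ :=
  theta τ z * theta τ (μ + γ) / (theta τ (z - γ) * theta τ μ)

/-- `β(z,μ) = -θ(z+μ)θ(γ)/(θ(z-γ)θ(μ))`. -/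
def betaF (τ γ z μ : ℂ) : ℂ :=
  -(theta τ (z + μ) * theta τ γ) / (theta τ (z - γ) * theta τ μ)

/-- The elliptic dynamical R-matrix of `E_{τ,γ/2}(gl_N)` on `ℂ^N ⊗ ℂ^N`.
Entry `((i,j),(k,l))` is the coefficient of `e_i ⊗ e_j` in `R (e_k ⊗ e_l)`. -/
def Rmat (N : ℕ) (τ γ z : ℂ) (lam : Fin N → ℂ) :
    Matrix (Fin N × Fin N) (Fin N × Fin N) ℂ := fun p q =>
  if p.1 = p.2 then (if q = p then 1 else 0)
  else (if q = p then alphaF τ γ z (lam p.1 - lam p.2) else 0) +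
    (if q = (p.2, p.1) then betaF τ γ z (lam p.1 - lam p.2) else 0)

/-- `λ - γ ∑_{c ∈ S} h^{(c)}` evaluated on the configuration `g` of basis indices. -/
def shiftL {n N : ℕ} (γ : ℂ) (lam : Fin N → ℂ) (S : Finset (Fin n)) (g : Fin n → Fin N) :
    Fin N → ℂ :=
  fun i => lam i - γ * ((S.filter fun c => g c = i).card : ℂ)

/-- `R(z, λ - γ ∑_{c∈S} h^{(c)})^{(a b)}` acting on `(ℂ^N)^{⊗ n}`. -/
def Rop (N n : ℕ) (τ γ z : ℂ) (lam : Fin N → ℂ) (S : Finset (Fin n)) (a b : Fin n) :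
    Matrix (Fin n → Fin N) (Fin n → Fin N) ℂ := fun f g =>
  if ∀ c, c ≠ a → c ≠ b → f c = g c then
    Rmat N τ γ z (shiftL γ lam S g) (f a, f b) (g a, g b)
  else 0

/-- The operators `W_n(z,λ)`, defined recursively:  `W_1 = 1` and
`W_{n+1}(z,λ) = R(z_1-z_2, λ-γ∑_{j=3}^{n+1}h^{(j)})^{(12)} ⋯ R(z_1-z_{n+1},λ)^{(1 n+1)}
  (1 ⊗ W_n(z_2,…,z_{n+1}, λ-γh^{(1)}))` (tensor factors indexed `0,…,n`). -/
def Wrec (N : ℕ) (τ γ : ℂ) : (n : ℕ) → (Fin n → ℂ) → (Fin N → ℂ) →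
    Matrix (Fin n → Fin N) (Fin n → Fin N) ℂ
  | 0, _, _ => 1
  | n + 1, z, lam =>
    (((List.finRange n).map fun j : Fin n =>
      Rop N (n + 1) τ γ (z 0 - z j.succ) lam
        (Finset.univ.filter fun c : Fin (n + 1) => j.succ < c) 0 j.succ).prod) *
      Matrix.of (fun f g : Fin (n + 1) → Fin N =>
        if f 0 = g 0 then
          Wrec N τ γ n (fun j => z j.succ) (fun i => lam i - if g 0 = i then γ else 0)
            (Fin.tail f) (Fin.tail g)
        else 0)

/-- `W^S_n(λ) = W_n(z^S, λ)` with `z^S = (0, γ, 2γ, …, (n-1)γ)`. -/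
def WS (N n : ℕ) (τ γ : ℂ) (lam : Fin N → ℂ) :
    Matrix (Fin n → Fin N) (Fin n → Fin N) ℂ :=
  Wrec N τ γ n (fun j => ((j : ℕ) : ℂ) * γ) lam

/-- `z^∧ = ((n-1)γ, …, 2γ, γ, 0)`. -/
def zWedge (n : ℕ) (γ : ℂ) : Fin n → ℂ := fun j => ((n - 1 - (j : ℕ) : ℕ) : ℂ) * γ

/-- `W^∧_n(λ) = lim_{z → z^∧} ∏_{j=1}^{n-1} (z_j - z_{j+1} - γ) · ρ W_n(z,λ) ρ`,
where `ρ` reverses the order of the tensor factors. -/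
def Wwedge (N n : ℕ) (τ γ : ℂ) (lam : Fin N → ℂ) :
    Matrix (Fin n → Fin N) (Fin n → Fin N) ℂ :=
  limUnder (𝓝[≠] zWedge n γ) fun z : Fin n → ℂ =>
    (∏ j : Fin n, if h : (j : ℕ) + 1 < n then z j - z ⟨(j : ℕ) + 1, h⟩ - γ else 1) •
      Matrix.of fun f g : Fin n → Fin N => Wrec N τ γ n z lam (f ∘ Fin.rev) (g ∘ Fin.rev)

/-- The space `S²(ℂ^N)` of symmetric tensors in `ℂ^N ⊗ ℂ^N`. -/
def symPair (N : ℕ) : Submodule ℂ ((Fin N × Fin N) → ℂ) where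
  carrier := {v | ∀ p : Fin N × Fin N, v p = v (p.2, p.1)}
  add_mem' := by intro a b ha hb p; simp only [Pi.add_apply, ha p, hb p]
  zero_mem' := by intro p; rfl
  smul_mem' := by intro c v hv p; simp only [Pi.smul_apply, hv p]

/-- `R^{reg}(γ,λ) = lim_{z→γ} (z-γ) R(z,λ)`. -/
def Rreg (N : ℕ) (τ γ : ℂ) (lam : Fin N → ℂ) : Matrix (Fin N × Fin N) (Fin N × Fin N) ℂ :=
  limUnder (𝓝[≠] γ) fun z : ℂ => (z - γ) • Rmat N τ γ z lam

/-- The flip `P : u ⊗ v ↦ v ⊗ u` on `ℂ^N ⊗ ℂ^N`. -/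
def Pmat (N : ℕ) : Matrix (Fin N × Fin N) (Fin N × Fin N) ℂ := fun p q =>
  if q = (p.2, p.1) then 1 else 0

/-- The space `S^n(ℂ^N)` of symmetric tensors in `(ℂ^N)^{⊗n}`. -/
def symTensors (N n : ℕ) : Submodule ℂ ((Fin n → Fin N) → ℂ) where
  carrier := {v | ∀ (σ : Equiv.Perm (Fin n)) (f : Fin n → Fin N), v (f ∘ σ) = v f}
  add_mem' := by intro a b ha hb σ f; simp only [Pi.add_apply, ha σ f, hb σ f]
  zero_mem' := by intro σ f; rfl
  smul_mem' := by intro c v hv σ f; simp only [Pi.smul_apply, hv σ f]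

/-- `J_n(ℂ^N)`: the span of tensors `σ v - sign(σ) v`. -/
def Jspan (N n : ℕ) : Submodule ℂ ((Fin n → Fin N) → ℂ) :=
  Submodule.span ℂ {w | ∃ (σ : Equiv.Perm (Fin n)) (v : (Fin n → Fin N) → ℂ),
    w = (fun f => v (f ∘ σ)) - ((Equiv.Perm.sign σ : ℤ) : ℂ) • v}

/-- `ℂ^N ⊗ W ⊆ ℂ^N ⊗ (ℂ^N)^{⊗ n}` for a subspace `W ⊆ (ℂ^N)^{⊗ n}`. -/
def consSlice (N n : ℕ) (W : Submodule ℂ ((Fin n → Fin N) → ℂ)) :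
    Submodule ℂ ((Fin (n + 1) → Fin N) → ℂ) where
  carrier := {v | ∀ i : Fin N, (fun g : Fin n → Fin N => v (Fin.cons i g)) ∈ W}
  add_mem' := by intro a b ha hb i; exact W.add_mem (ha i) (hb i)
  zero_mem' := by intro i; exact W.zero_mem
  smul_mem' := by intro c v hv i; exact W.smul_mem c (hv i)

/-- The `L`-operator of `V^{⊗n}(w)`:
`L(z,λ) = R(z-w, λ-γ∑_{j=2}^n h^{(j)})^{(01)} ⋯ R(z-w-γ(n-1), λ)^{(0n)}`,
acting on `ℂ^N ⊗ (ℂ^N)^{⊗n}` with factors numbered `0,…,n`. -/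
def Lop (N n : ℕ) (τ γ z w : ℂ) (lam : Fin N → ℂ) :
    Matrix (Fin (n + 1) → Fin N) (Fin (n + 1) → Fin N) ℂ :=
  ((List.finRange n).map fun j : Fin n =>
    Rop N (n + 1) τ γ (z - w - (j : ℕ) * γ) lam
      (Finset.univ.filter fun c : Fin (n + 1) => j.succ < c) 0 j.succ).prod

/-- The `L`-operator for the opposite coproduct:
`L'(z,λ) = R(z-w-γ(n-1), λ-γ∑_{j=1}^{n-1} h^{(j)})^{(0n)} ⋯ R(z-w, λ)^{(01)}`. -/
def Lop' (N n : ℕ) (τ γ z w : ℂ) (lam : Fin N → ℂ) :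
    Matrix (Fin (n + 1) → Fin N) (Fin (n + 1) → Fin N) ℂ :=
  (((List.finRange n).reverse).map fun j : Fin n =>
    Rop N (n + 1) τ γ (z - w - (j : ℕ) * γ) lam
      (Finset.univ.filter fun c : Fin (n + 1) => 0 < c ∧ c < j.succ) 0 j.succ).prod

/-- `Id ⊗ M` on `ℂ^N ⊗ (ℂ^N)^{⊗n}`. -/
def idTensor (N n : ℕ) (M : Matrix (Fin n → Fin N) (Fin n → Fin N) ℂ) :
    Matrix (Fin (n + 1) → Fin N) (Fin (n + 1) → Fin N) ℂ :=
  Matrix.of fun f g => if f 0 = g 0 then M (Fin.tail f) (Fin.tail g) else 0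

/-- `Id ⊗ M(λ - γ h^{(0)})` on `ℂ^N ⊗ (ℂ^N)^{⊗n}`. -/
def idTensorShift (N n : ℕ) (γ : ℂ)
    (M : (Fin N → ℂ) → Matrix (Fin n → Fin N) (Fin n → Fin N) ℂ) (lam : Fin N → ℂ) :
    Matrix (Fin (n + 1) → Fin N) (Fin (n + 1) → Fin N) ℂ :=
  Matrix.of fun f g =>
    if f 0 = g 0 then M (fun i => lam i - if g 0 = i then γ else 0) (Fin.tail f) (Fin.tail g)
    else 0

/-- The zero-weight symmetric tensor `e`: the sum of all `e_{i_1} ⊗ ⋯ ⊗ e_{i_n}` over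
sequences in which each index occurs exactly `ℓ` times. -/
def evec (N n ℓ : ℕ) : (Fin n → Fin N) → ℂ := fun f =>
  if ∀ i : Fin N, (Finset.univ.filter fun j => f j = i).card = ℓ then 1 else 0

/-- The multi-index of `ē = e_1^{⊗ℓ} ⊗ ⋯ ⊗ e_N^{⊗ℓ}`. -/
def barIdx (N ℓ : ℕ) : Fin (N * ℓ) → Fin N := fun j =>
  ⟨j.val / ℓ, by
    have h : (j : ℕ) < ℓ * N := by rw [Nat.mul_comm ℓ N]; exact j.isLt
    exact Nat.div_lt_of_lt_mul h⟩

/-- `g_{N,ℓ}(λ) = ∏_{1≤j<k≤N} ∏_{s=1}^ℓ θ(λ_j-λ_k+γs)/θ(λ_j-λ_k-γ(s-1))`. -/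
def gfun (N ℓ : ℕ) (τ γ : ℂ) (lam : Fin N → ℂ) : ℂ :=
  ∏ j : Fin N, ∏ k : Fin N,
    if j < k then
      ∏ s ∈ Finset.Icc 1 ℓ,
        theta τ (lam j - lam k + γ * (s : ℂ)) / theta τ (lam j - lam k - γ * ((s : ℂ) - 1))
    else 1

/-- The permutation induced by a word in the generators `s_1, …, s_n` of `S_{n+1}`:
`π_k = s_{a_1} ∘ ⋯ ∘ s_{a_k}` (letters `a` act as the transposition of `a` and `a+1`). -/
def permOfWord {n : ℕ} : List (Fin n) → Equiv.Perm (Fin (n + 1))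
  | [] => 1
  | a :: rest => Equiv.swap a.castSucc a.succ * permOfWord rest

/-- The product of R-matrices attached to a word (with accumulated permutation `π`):
`W_w(z,λ) = F_k ⋯ F_1` where for the `t`-th letter `a`
`F_t = R(z_{π(a)} - z_{π(a+1)}, λ - γ ∑_{b<a} h^{(π(b))})^{(π(a), π(a+1))}`,
`π = π_{t-1}` the permutation induced by the earlier letters. -/
def Wword (N : ℕ) {n : ℕ} (τ γ : ℂ) (z : Fin (n + 1) → ℂ) (lam : Fin N → ℂ) :
    List (Fin n) → Equiv.Perm (Fin (n + 1)) →
      Matrix (Fin (n + 1) → Fin N) (Fin (n + 1) → Fin N) ℂ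
  | [], _ => 1
  | a :: rest, π =>
      Wword N τ γ z lam rest (π * Equiv.swap a.castSucc a.succ) *
        Rop N (n + 1) τ γ (z (π a.castSucc) - z (π a.succ)) lam
          ((Finset.univ.filter fun c : Fin (n + 1) => (c : ℕ) < (a : ℕ)).image π)
          (π a.castSucc) (π a.succ)

/-- The fused R-matrix `𝓡_{V^{⊗m}(z), V^{⊗n}(w)}(λ)` on `(ℂ^N)^{⊗(m+n)}`
(first block: factors `0,…,m-1`; second block: factors `m,…,m+n-1`). -/
def Rmn (N m n : ℕ) (τ γ z w : ℂ) (lam : Fin N → ℂ) :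
    Matrix (Fin (m + n) → Fin N) (Fin (m + n) → Fin N) ℂ :=
  ((List.finRange m).map fun a : Fin m =>
    ((List.finRange n).map fun j : Fin n =>
      Rop N (m + n) τ γ (z + (a : ℕ) * γ - w - (j : ℕ) * γ) lam
        (Finset.univ.filter fun c : Fin (m + n) =>
          (c : ℕ) < (a : ℕ) ∨ m + (j : ℕ) < (c : ℕ))
        (Fin.castAdd n a) (Fin.natAdd m j)).prod).prod

/-- `A ⊗ B ⊆ (ℂ^N)^{⊗m} ⊗ (ℂ^N)^{⊗n}`, realised as `(A ⊗ V₂) ∩ (V₁ ⊗ B)`. -/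
def blockSub (N m n : ℕ) (A : Submodule ℂ ((Fin m → Fin N) → ℂ))
    (B : Submodule ℂ ((Fin n → Fin N) → ℂ)) :
    Submodule ℂ ((Fin (m + n) → Fin N) → ℂ) where
  carrier := {v |
    (∀ g : Fin n → Fin N, (fun f : Fin m → Fin N => v (Fin.append f g)) ∈ A) ∧
    ∀ f : Fin m → Fin N, (fun g : Fin n → Fin N => v (Fin.append f g)) ∈ B}
  add_mem' := by
    intro x y hx hy
    exact ⟨fun g => A.add_mem (hx.1 g) (hy.1 g), fun f => B.add_mem (hx.2 f) (hy.2 f)⟩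
  zero_mem' := ⟨fun _ => A.zero_mem, fun _ => B.zero_mem⟩
  smul_mem' := by
    intro c x hx
    exact ⟨fun g => A.smul_mem c (hx.1 g), fun f => B.smul_mem c (hx.2 f)⟩

/-- Matrix element `L_{jk}(z,λ)` of the `L`-operator (evaluation point `w = 0`),
as an operator on `(ℂ^N)^{⊗n}`: `L(z,λ)(e_k ⊗ v) = ∑_j e_j ⊗ L_{jk}(z,λ) v`. -/
def LmatEl (N n : ℕ) (τ γ z : ℂ) (lam : Fin N → ℂ) (j k : Fin N)
    (v : (Fin n → Fin N) → ℂ) : (Fin n → Fin N) → ℂ := fun g =>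
  (Lop N n τ γ z 0 lam).mulVec
    (fun f => (if f 0 = k then (1 : ℂ) else 0) * v (Fin.tail f)) (Fin.cons j g)

/-- `L_{j_{σ(1)} j_1}(z, λ-γ(ω_{j_2}+⋯+ω_{j_m})) ∘ ⋯ ∘ L_{j_{σ(m)} j_m}(z-(m-1)γ, λ)`. -/
def chainT (N n m : ℕ) (τ γ z : ℂ) (lam : Fin N → ℂ) (jt : Fin m → Fin N)
    (σ : Equiv.Perm (Fin m)) (v : (Fin n → Fin N) → ℂ) : (Fin n → Fin N) → ℂ :=
  (List.finRange m).foldr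
    (fun (t : Fin m) acc =>
      LmatEl N n τ γ (z - (t.val : ℂ) * γ)
        (fun i => lam i -
          γ * ((Finset.univ.filter fun s : Fin m => t < s ∧ jt s = i).card : ℂ))
        (jt (σ t)) (jt t) acc)
    v

/-- The transfer matrix `T_m(z)`, acting on scalar functions of `λ` via the identification
of the zero weight space of `S^{Nℓ}(ℂ^N)` with `ℂ` by the basis vector `e`:
`T_m(z) f(λ) = ∑_{j_1<⋯<j_m} ∑_{σ} (-1)^σ [L_{j_{σ(1)} j_1}(z,λ-γ(ω_{j_2}+⋯+ω_{j_m})) ⋯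
L_{j_{σ(m)} j_m}(z-(m-1)γ, λ)] e · f(λ-γ(ω_{j_1}+⋯+ω_{j_m}))`. -/
def Tm (N ℓ m : ℕ) (τ γ z : ℂ) (lam : Fin N → ℂ) (f : (Fin N → ℂ) → ℂ) : ℂ :=
  ∑ jt ∈ Finset.univ.filter fun jt : Fin m → Fin N => ∀ s t : Fin m, s < t → jt s < jt t,
    ∑ σ : Equiv.Perm (Fin m),
      ((Equiv.Perm.sign σ : ℤ) : ℂ) *
        chainT N (N * ℓ) m τ γ z lam jt σ (evec N (N * ℓ) ℓ) (barIdx N ℓ) *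
        f fun i => lam i - if ∃ t, jt t = i then γ else 0

/-- The `m`-th Ruijsenaars operator with coupling constant `ℓ`:
`M_m f(λ) = ∑_{|J|=m} ∏_{j∈J,k∉J} θ(λ_j-λ_k+ℓγ)/θ(λ_j-λ_k) · f(λ-γ∑_{j∈J}ω_j)`. -/
def Mm (N ℓ m : ℕ) (τ γ : ℂ) (f : (Fin N → ℂ) → ℂ) (lam : Fin N → ℂ) : ℂ :=
  ∑ J ∈ Finset.powersetCard m (Finset.univ : Finset (Fin N)),
    (∏ j ∈ J, ∏ k ∈ Jᶜ, theta τ (lam j - lam k + (ℓ : ℂ) * γ) / theta τ (lam j - lam k)) *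
      f fun i => lam i - if i ∈ J then γ else 0

/-- The transfer matrix with auxiliary space indexed by `ι` (weights `wt`) and quantum
space indexed by `ι₃`: `T f(λ) = ∑_μ tr_{W[μ]}(𝓡(λ)) f(λ-γμ)`. -/
def transferOp {N : ℕ} {ι ι₃ : Type} [Fintype ι] [Fintype ι₃] (γ : ℂ)
    (wt : ι → Fin N → ℂ) (R : (Fin N → ℂ) → Matrix (ι × ι₃) (ι × ι₃) ℂ)
    (f : (Fin N → ℂ) → ι₃ → ℂ) : (Fin N → ℂ) → ι₃ → ℂ := fun lam b =>
  ∑ a : ι, ∑ b' : ι₃, R lam (a, b) (a, b') * f (fun r => lam r - γ * wt a r) b'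

/-- Each term of the series for `theta` is a fixed prefactor times a term of `jacobiTheta₂`. -/
lemma theta_term_eq (τ z : ℂ) (j : ℤ) :
    Complex.exp ((Real.pi : ℂ) * Complex.I * ((j : ℂ) + 1 / 2) ^ 2 * τ +
      2 * (Real.pi : ℂ) * Complex.I * ((j : ℂ) + 1 / 2) * (z + 1 / 2)) =
    Complex.exp ((Real.pi : ℂ) * Complex.I * (τ / 4 + z + 1 / 2)) *
      jacobiTheta₂_term j (z + 1 / 2 + τ / 2) τ := by
  rw [jacobiTheta₂_term, ← Complex.exp_add]
  congr 1
  ring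

lemma theta_eq_jacobiTheta₂ (τ z : ℂ) :
    theta τ z = -(Complex.exp ((Real.pi : ℂ) * Complex.I * (τ / 4 + z + 1 / 2)) *
      jacobiTheta₂ (z + 1 / 2 + τ / 2) τ) := by
  rw [theta, jacobiTheta₂, ← tsum_mul_left]
  simp_rw [theta_term_eq]

lemma summable_norm_theta_term {τ : ℂ} (hτ : 0 < τ.im) (z : ℂ) :
    Summable fun j : ℤ => ‖Complex.exp ((Real.pi : ℂ) * Complex.I * ((j : ℂ) + 1 / 2) ^ 2 * τ +
      2 * (Real.pi : ℂ) * Complex.I * ((j : ℂ) + 1 / 2) * (z + 1 / 2))‖ := by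
  simp_rw [theta_term_eq]
  exact (((summable_jacobiTheta₂_term_iff _ τ).2 hτ).mul_left _).norm

lemma theta_neg (τ z : ℂ) : theta τ (-z) = -theta τ z := by
  rw [theta, theta, neg_neg, ← ((Equiv.neg ℤ).trans (Equiv.subRight 1)).tsum_eq, ← tsum_neg]
  congr 1
  funext j
  have h : Complex.exp (2 * (Real.pi : ℂ) * Complex.I * (j + 1 / 2)) = -1 := by
    rw [show 2 * (Real.pi : ℂ) * Complex.I * (j + 1 / 2) =
      Real.pi * Complex.I + (j : ℂ) * (2 * Real.pi * Complex.I) by ring,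
      Complex.exp_add, Complex.exp_int_mul_two_pi_mul_I, Complex.exp_pi_mul_I, mul_one]
  rw [neg_eq_neg_one_mul, ← h, ← Complex.exp_add]
  congr 1
  simp
  ring

lemma differentiable_theta {τ : ℂ} (hτ : 0 < τ.im) : Differentiable ℂ (theta τ) := by
  have h : theta τ = fun z => -(Complex.exp ((Real.pi : ℂ) * Complex.I * (τ / 4 + z + 1 / 2)) *
      jacobiTheta₂ (z + 1 / 2 + τ / 2) τ) := funext (theta_eq_jacobiTheta₂ τ)
  rw [h]
  intro z
  have h2 : DifferentiableAt ℂ (fun z => jacobiTheta₂ (z + 1 / 2 + τ / 2) τ) z :=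
    (differentiableAt_jacobiTheta₂_fst (z + 1 / 2 + τ / 2) hτ).comp z
      (f := fun z => z + 1 / 2 + τ / 2) (by fun_prop)
  exact (DifferentiableAt.mul (by fun_prop) h2).neg

lemma exists_jacobiTheta₂_ne_zero {τ : ℂ} (hτ : 0 < τ.im) : ∃ z, jacobiTheta₂ z τ ≠ 0 := by
  by_contra! h0
  have key := intervalIntegral.hasSum_integral_of_dominated_convergence
    (μ := MeasureTheory.volume) (a := 0) (b := 1) (F := fun (n : ℤ) (t : ℝ) =>
      jacobiTheta₂_term n t τ) (f := fun _ => 0)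
    (fun n _ => ‖jacobiTheta₂_term n 0 τ‖)
    (fun n => by
      refine Continuous.aestronglyMeasurable ?_
      unfold jacobiTheta₂_term
      fun_prop)
    (fun n => Filter.Eventually.of_forall fun t _ => by
      simp [norm_jacobiTheta₂_term])
    (Filter.Eventually.of_forall fun t _ => ((summable_jacobiTheta₂_term_iff 0 τ).2 hτ).norm)
    (by simp)
    (Filter.Eventually.of_forall fun t _ => by
      have := hasSum_jacobiTheta₂_term (t : ℂ) hτ
      rwa [h0] at this)
  have h1 : ∀ n : ℤ, n ≠ 0 → ∫ t in (0 : ℝ)..1, jacobiTheta₂_term n t τ = 0 := by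
    intro n hn
    have hc : 2 * (Real.pi : ℂ) * Complex.I * n ≠ 0 := by
      simp [hn, Real.pi_ne_zero]
    simp_rw [jacobiTheta₂_term, Complex.exp_add]
    rw [intervalIntegral.integral_mul_const, integral_exp_mul_complex hc]
    have : Complex.exp (2 * (Real.pi : ℂ) * Complex.I * n * (1 : ℝ)) = 1 := by
      rw [← Complex.exp_int_mul_two_pi_mul_I n]
      congr 1
      push_cast
      ring
    rw [this]
    simp
  have h2 := key.unique (hasSum_single 0 h1)
  simp [jacobiTheta₂_term] at h2

lemma isOpen_theta_ne_zero {τ : ℂ} (hτ : 0 < τ.im) : IsOpen {z | theta τ z ≠ 0} :=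
  isOpen_ne_fun (differentiable_theta hτ).continuous continuous_const

lemma dense_theta_ne_zero {τ : ℂ} (hτ : 0 < τ.im) : Dense {z | theta τ z ≠ 0} := by
  have han : AnalyticOnNhd ℂ (theta τ) Set.univ :=
    (differentiable_theta hτ).differentiableOn.analyticOnNhd isOpen_univ
  rw [dense_iff_closure_eq, Set.eq_univ_iff_forall]
  intro z
  by_contra hz
  rw [mem_closure_iff_frequently, Filter.not_frequently] at hz
  have h0 : Set.EqOn (theta τ) 0 Set.univ :=
    han.eqOn_zero_of_preconnected_of_eventuallyEq_zero isPreconnected_univ (Set.mem_univ z)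
      (hz.mono fun x hx => by simpa using hx)
  obtain ⟨y, hy⟩ := exists_jacobiTheta₂_ne_zero hτ
  have h1 := h0 (Set.mem_univ (y - 1 / 2 - τ / 2))
  rw [theta_eq_jacobiTheta₂] at h1
  rw [show y - 1 / 2 - τ / 2 + 1 / 2 + τ / 2 = y by ring] at h1
  simp [hy] at h1

/-- Reindexing `ℤ × ℤ` by sum and difference: pairs `(s, d)` of opposite parity. -/
def sumDiffEquiv : (ℤ × ℤ) ⊕ (ℤ × ℤ) ≃ ℤ × ℤ where
  toFun := Sum.elim (fun p => (p.1 + p.2, p.1 - p.2 - 1)) (fun p => (p.1 + p.2, p.1 - p.2))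
  invFun p := if (p.1 - p.2) % 2 = 1 then .inl ((p.1 + p.2 + 1) / 2, (p.1 - p.2 - 1) / 2)
    else .inr ((p.1 + p.2) / 2, (p.1 - p.2) / 2)
  left_inv := by
    rintro (⟨a, b⟩ | ⟨a, b⟩)
    · refine (if_pos ?_).trans ?_
      · simp only [Sum.elim_inl]
        omega
      · simp only [Sum.elim_inl, Sum.inl.injEq, Prod.mk.injEq]
        omega
    · refine (if_neg ?_).trans ?_
      · simp only [Sum.elim_inr]
        omega
      · simp only [Sum.elim_inr, Sum.inr.injEq, Prod.mk.injEq]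
        omega
  right_inv := by
    rintro ⟨a, b⟩
    dsimp only
    split_ifs with h
    · simp only [Sum.elim_inl, Prod.mk.injEq]
      omega
    · simp only [Sum.elim_inr, Prod.mk.injEq]
      omega

/-- The level two theta series over even integers. -/
def thetaEven (τ x : ℂ) : ℂ := ∑' s : ℤ, Complex.exp (2 * (Real.pi : ℂ) * Complex.I *
  ((s : ℂ) ^ 2 * τ + 2 * s * x))

/-- The level two theta series over odd integers. -/
def thetaOdd (τ x : ℂ) : ℂ := ∑' s : ℤ, Complex.exp (2 * (Real.pi : ℂ) * Complex.I *
  (((s : ℂ) + 1 / 2) ^ 2 * τ + 2 * (s + 1 / 2) * x))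

lemma summable_norm_thetaEven_term {τ : ℂ} (hτ : 0 < τ.im) (x : ℂ) :
    Summable fun s : ℤ => ‖Complex.exp (2 * (Real.pi : ℂ) * Complex.I *
      ((s : ℂ) ^ 2 * τ + 2 * s * x))‖ := by
  have h : 0 < (2 * τ).im := by simpa using hτ
  refine ((summable_jacobiTheta₂_term_iff (2 * x) (2 * τ)).2 h).norm.congr fun s => ?_
  rw [jacobiTheta₂_term]
  congr 2
  ring

lemma summable_norm_thetaOdd_term {τ : ℂ} (hτ : 0 < τ.im) (x : ℂ) :
    Summable fun s : ℤ => ‖Complex.exp (2 * (Real.pi : ℂ) * Complex.I *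
      (((s : ℂ) + 1 / 2) ^ 2 * τ + 2 * (s + 1 / 2) * x))‖ := by
  have h : 0 < (2 * τ).im := by simpa using hτ
  refine (((summable_jacobiTheta₂_term_iff (2 * x + τ) (2 * τ)).2 h).mul_left
    (Complex.exp (2 * Real.pi * Complex.I * (τ / 4 + x)))).norm.congr fun s => ?_
  rw [jacobiTheta₂_term, ← Complex.exp_add]
  congr 2
  ring

lemma theta_add_mul_theta_sub {τ : ℂ} (hτ : 0 < τ.im) (x y : ℂ) :
    theta τ (x + y) * theta τ (x - y) =
      thetaEven τ x * thetaOdd τ y - thetaOdd τ x * thetaEven τ y := by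
  have hs := summable_mul_of_summable_norm (summable_norm_theta_term hτ (x + y))
    (summable_norm_theta_term hτ (x - y))
  rw [theta, theta, neg_mul_neg, tsum_mul_tsum_of_summable_norm (summable_norm_theta_term hτ _)
    (summable_norm_theta_term hτ _), ← sumDiffEquiv.tsum_eq]
  rw [← sumDiffEquiv.summable_iff] at hs
  have h := Summable.tsum_sum (hs.comp_injective Sum.inl_injective)
    (hs.comp_injective Sum.inr_injective)
  refine h.trans ?_
  rw [thetaEven, thetaOdd, thetaOdd, thetaEven,
    tsum_mul_tsum_of_summable_norm (summable_norm_thetaEven_term hτ _)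
      (summable_norm_thetaOdd_term hτ _),
    tsum_mul_tsum_of_summable_norm (summable_norm_thetaOdd_term hτ _)
      (summable_norm_thetaEven_term hτ _),
    sub_eq_add_neg (tsum _), ← tsum_neg]
  congr 1
  · congr 1
    funext ⟨a, b⟩
    simp only [Function.comp, sumDiffEquiv, Equiv.coe_fn_mk, Sum.elim_inl]
    have h1 : ∀ u : ℂ, Complex.exp (u + (a : ℂ) * (2 * Real.pi * Complex.I)) = Complex.exp u := by
      intro u
      rw [Complex.exp_add, Complex.exp_int_mul_two_pi_mul_I, mul_one]
    rw [← Complex.exp_add, ← Complex.exp_add, ← h1 (2 * _ * _ * _ + _)]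
    congr 1
    push_cast
    ring
  · congr 1
    funext ⟨a, b⟩
    simp only [Function.comp, sumDiffEquiv, Equiv.coe_fn_mk, Sum.elim_inr]
    have h1 : Complex.exp (((a : ℤ) : ℂ) * (2 * Real.pi * Complex.I) + Real.pi * Complex.I) = -1 := by
      rw [Complex.exp_add, Complex.exp_int_mul_two_pi_mul_I, Complex.exp_pi_mul_I, one_mul]
    rw [← Complex.exp_add, ← Complex.exp_add, neg_eq_neg_one_mul, ← h1, ← Complex.exp_add]
    congr 1
    push_cast
    ring

/-- The Weierstrass three-term identity. -/
lemma theta_three_term {τ : ℂ} (hτ : 0 < τ.im) (a b c d : ℂ) :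
    theta τ (a + b) * theta τ (a - b) * (theta τ (c + d) * theta τ (c - d)) -
      theta τ (a + c) * theta τ (a - c) * (theta τ (b + d) * theta τ (b - d)) +
      theta τ (a + d) * theta τ (a - d) * (theta τ (b + c) * theta τ (b - c)) = 0 := by
  simp only [theta_add_mul_theta_sub hτ]
  ring

lemma theta_addition_formula {τ : ℂ} (hτ : 0 < τ.im) (u v m n : ℂ) :
    theta τ u * theta τ v * theta τ (u + v + m + n) * theta τ (n - m) =
      theta τ (u + m) * theta τ (u + v + n) * theta τ (v + m) * theta τ n -
        theta τ (u + n) * theta τ (u + v + m) * theta τ (v + n) * theta τ m := by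
  have h := theta_three_term hτ (n + (u + v) / 2) (m + (u + v) / 2) ((u + v) / 2) ((u - v) / 2)
  ring_nf at h ⊢
  linear_combination h

lemma alphaF_mul_comm (τ γ a b m n : ℂ) :
    alphaF τ γ a m * alphaF τ γ b n = alphaF τ γ b m * alphaF τ γ a n := by
  simp only [alphaF, div_eq_mul_inv, mul_inv]
  ring

section ScalarIdentities

variable {τ γ u v w m p q : ℂ}

lemma alphaF_mul_betaF_shift (hτ : 0 < τ.im) (hw : w = u + v) (hp : p = m - γ) (hq : q = -m)
    (hu : theta τ (u - γ) ≠ 0) (hv : theta τ (v - γ) ≠ 0) (hw0 : theta τ (w - γ) ≠ 0)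
    (hm : theta τ m ≠ 0) (hp0 : theta τ p ≠ 0) :
    alphaF τ γ w m * betaF τ γ v p =
      alphaF τ γ v m * betaF τ γ w p * betaF τ γ u q + betaF τ γ v m * alphaF τ γ u m := by
  subst hw hp hq
  have h : theta τ (u + v) * theta τ (v + (m - γ)) * theta τ (u - γ) * theta τ m =
      theta τ (u + -m) * theta τ (u + v + (m - γ)) * theta τ (-γ) * theta τ (-v) -
        theta τ u * theta τ (u + v - γ) * theta τ (m - γ) * theta τ (-(v + m)) := by
    have h := theta_addition_formula hτ (u + v) (v - γ + m) (-v - m) (-v)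
    ring_nf at h ⊢
    linear_combination h
  simp only [alphaF, betaF]
  simp only [theta_neg] at h ⊢
  field_simp
  linear_combination -theta τ (m + γ) * theta τ γ * h

lemma betaF_shift (hτ : 0 < τ.im) (hw : w = u + v) (hp : p = m - γ) (hq : q = -m)
    (hu : theta τ (u - γ) ≠ 0) (hv : theta τ (v - γ) ≠ 0) (hw0 : theta τ (w - γ) ≠ 0)
    (hm : theta τ m ≠ 0) (hp0 : theta τ p ≠ 0) :
    betaF τ γ w m =
      alphaF τ γ v m * betaF τ γ w p * alphaF τ γ u q + betaF τ γ v m * betaF τ γ u m := by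
  subst hw hp hq
  have h : theta τ (u + v + m) * theta τ (v - γ) * theta τ (u - γ) * theta τ m =
      theta τ u * theta τ (u + v + (m - γ)) * theta τ (-(m + γ)) * theta τ (-v) -
        theta τ (u + m) * theta τ (u + v - γ) * theta τ (-γ) * theta τ (-(v + m)) := by
    have h := theta_addition_formula hτ (u + v + m) (v - γ) (-v - m) (-v)
    ring_nf at h ⊢
    linear_combination h
  have e : theta τ (-m + γ) = -theta τ (m - γ) := by rw [← theta_neg]; congr 1; ring
  simp only [alphaF, betaF, e]
  simp only [theta_neg] at h ⊢
  field_simp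
  linear_combination -theta τ γ * h

lemma alphaF_mul_betaF_shift' (hτ : 0 < τ.im) (hw : w = u + v) (hp : p = -m - γ) (hq : q = -m)
    (hu : theta τ (u - γ) ≠ 0) (hv : theta τ (v - γ) ≠ 0) (hw0 : theta τ (w - γ) ≠ 0)
    (hm : theta τ m ≠ 0) (hp0 : theta τ p ≠ 0) :
    alphaF τ γ w m * betaF τ γ v p =
      alphaF τ γ u m * betaF τ γ v q + betaF τ γ u m * betaF τ γ w p * alphaF τ γ v m := by
  subst hw hp hq
  have h : theta τ (u + v) * theta τ (-(v + (-m - γ))) * theta τ (-(u - γ)) * theta τ m =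
      theta τ (v + -m) * theta τ (m + γ) * theta τ (-(u + v - γ)) * theta τ (-u) -
        theta τ v * theta τ γ * theta τ (-(u + v + (-m - γ))) * theta τ (-(u + m)) := by
    have h := theta_addition_formula hτ (u + v) (-v + γ + m) (-u - m) (-u)
    ring_nf at h ⊢
    linear_combination h
  have e : theta τ (-m - γ) = -theta τ (m + γ) := by rw [← theta_neg]; congr 1; ring
  simp only [alphaF, betaF, e] at hp0 ⊢
  rw [neg_ne_zero] at hp0
  simp only [theta_neg] at h ⊢
  field_simp
  linear_combination theta τ γ * h

variable {n s : ℂ}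

lemma alphaF_betaF_three_term (hτ : 0 < τ.im) (hw : w = u + v) (hs : s = m + n) (hq : q = -m)
    (hu : theta τ (u - γ) ≠ 0) (hv : theta τ (v - γ) ≠ 0) (hw0 : theta τ (w - γ) ≠ 0)
    (hm : theta τ m ≠ 0) (hn : theta τ n ≠ 0) (hs0 : theta τ s ≠ 0) :
    alphaF τ γ u m * betaF τ γ w s * betaF τ γ v q +
        betaF τ γ u m * betaF τ γ w n * alphaF τ γ v m =
      betaF τ γ v n * alphaF τ γ w m * betaF τ γ u s := by
  subst hw hs hq
  have h : theta τ v * theta τ (-(u + m)) * theta τ (-(m + n)) * theta τ (u + v + n) =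
      theta τ (-n) * theta τ (v + -m) * theta τ (-(u + v + (m + n))) * theta τ u -
        theta τ (u + v) * theta τ (-(u + (m + n))) * theta τ (-m) * theta τ (-(v + n)) := by
    have h := theta_addition_formula hτ v (-u - m) (-v - n) u
    ring_nf at h ⊢
    linear_combination h
  simp only [alphaF, betaF]
  simp only [theta_neg] at h ⊢
  field_simp
  linear_combination theta τ γ ^ 2 * theta τ (m + γ) * h

lemma alphaF_betaF_four_term (hτ : 0 < τ.im) (hw : w = u + v) (hs : s = m + n) (hq : q = -m)
    (hp : p = -n)
    (hu : theta τ (u - γ) ≠ 0) (hv : theta τ (v - γ) ≠ 0) (hw0 : theta τ (w - γ) ≠ 0)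
    (hm : theta τ m ≠ 0) (hn : theta τ n ≠ 0) (hs0 : theta τ s ≠ 0) :
    alphaF τ γ u m * betaF τ γ w s * alphaF τ γ v q +
        betaF τ γ u m * betaF τ γ w n * betaF τ γ v m =
      alphaF τ γ v n * betaF τ γ w s * alphaF τ γ u p +
        betaF τ γ v n * betaF τ γ w m * betaF τ γ u n := by
  subst hw hs hq hp
  have h1 : theta τ u * theta τ v * theta τ (u + v + (m + n)) * theta τ (n - m) =
      theta τ (u + m) * theta τ (u + v + n) * theta τ (v + m) * theta τ n -
        theta τ (u + n) * theta τ (u + v + m) * theta τ (v + n) * theta τ m := by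
    rw [← theta_addition_formula hτ, add_assoc (u + v)]
  have h2 : theta τ (m + γ) * theta τ (-m + γ) * theta τ (-n) * theta τ (-n) =
      theta τ m * theta τ (-n + γ) * theta τ (-m) * theta τ (-(n + γ)) -
        theta τ (-(n - m)) * theta τ γ * theta τ (-(m + n)) * theta τ (-γ) := by
    have h := theta_addition_formula hτ (γ + m) (γ - m) (-γ) (-γ - n)
    ring_nf at h ⊢
    linear_combination h
  simp only [alphaF, betaF]
  simp only [theta_neg] at h1 h2 ⊢
  field_simp
  linear_combination theta τ γ * theta τ u * theta τ v * theta τ (u + v + (m + n)) * h2 +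
    theta τ γ ^ 3 * theta τ (m + n) * h1

lemma alphaF_betaF_four_term_shift (hτ : 0 < τ.im) (hw : w = u + v) (hp : p = m - γ) (hq : q = -m)
    (hs : s = -p)
    (hu : theta τ (u - γ) ≠ 0) (hv : theta τ (v - γ) ≠ 0) (hw0 : theta τ (w - γ) ≠ 0)
    (hm : theta τ m ≠ 0) (hp0 : theta τ p ≠ 0) (hγ : theta τ γ ≠ 0) :
    alphaF τ γ u p * alphaF τ γ v s + betaF τ γ u p * betaF τ γ w q * betaF τ γ v p =
      alphaF τ γ v q * alphaF τ γ u m + betaF τ γ v q * betaF τ γ w p * betaF τ γ u q := by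
  have h1 : betaF τ γ w (-γ) = 1 := by
    rw [betaF, ← sub_eq_add_neg, theta_neg]
    field_simp
  have h := alphaF_betaF_four_term (γ := γ) (m := p) (n := q) hτ hw (s := -γ) (q := s) (p := m)
    (by rw [hp, hq]; ring) hs (by rw [hq, neg_neg]) hu hv hw0 hp0 (by rwa [hq, theta_neg, neg_ne_zero])
    (by rwa [theta_neg, neg_ne_zero])
  simpa only [h1, mul_one] using h

end ScalarIdentities

/-- The action of `R(z)` on the coordinates `A`, `B` of a vector at `e_i ⊗ e_j`, `e_j ⊗ e_i`,
where `μ` is the dynamical difference `λ_i - λ_j`. -/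
def rAct {N : ℕ} (τ γ z μ : ℂ) (i j : Fin N) (A B : ℂ) : ℂ :=
  if i = j then A else alphaF τ γ z μ * A + betaF τ γ z μ * B

/-- `x_i - x_j` for `x` shifted by `-s ω_k`. -/
def dynDiff {N : ℕ} (x : Fin N → ℂ) (s : ℂ) (k i j : Fin N) : ℂ :=
  x i - x j - (if k = i then s else 0) + (if k = j then s else 0)

/-- `R(z, x - s h^{(3)})^{(12)}` on three tensor factors. -/
def rAct12 {N : ℕ} (τ γ s z : ℂ) (x : Fin N → ℂ) (F : Fin N → Fin N → Fin N → ℂ)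
    (i j k : Fin N) : ℂ :=
  rAct τ γ z (dynDiff x s k i j) i j (F i j k) (F j i k)

/-- `R(z, x - s h^{(2)})^{(13)}` on three tensor factors. -/
def rAct13 {N : ℕ} (τ γ s z : ℂ) (x : Fin N → ℂ) (F : Fin N → Fin N → Fin N → ℂ)
    (i j k : Fin N) : ℂ :=
  rAct τ γ z (dynDiff x s j i k) i k (F i j k) (F k j i)

/-- `R(z, x - s h^{(1)})^{(23)}` on three tensor factors. -/
def rAct23 {N : ℕ} (τ γ s z : ℂ) (x : Fin N → ℂ) (F : Fin N → Fin N → Fin N → ℂ)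
    (i j k : Fin N) : ℂ :=
  rAct τ γ z (dynDiff x s i j k) j k (F i j k) (F i k j)

/-- The dynamical Yang–Baxter equation on three tensor factors. -/
lemma rAct_yangBaxter {N : ℕ} {τ γ u v w : ℂ} (hτ : 0 < τ.im) (hw : w = u + v)
    (hu : theta τ (u - γ) ≠ 0) (hv : theta τ (v - γ) ≠ 0) (hw0 : theta τ (w - γ) ≠ 0)
    (hγ : theta τ γ ≠ 0) (x : Fin N → ℂ) (hx : ∀ i j, i ≠ j → theta τ (x i - x j) ≠ 0)
    (hx' : ∀ i j, i ≠ j → theta τ (x i - x j + γ) ≠ 0)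
    (F : Fin N → Fin N → Fin N → ℂ) (i j k : Fin N) :
    rAct12 τ γ γ u x (rAct13 τ γ 0 w x (rAct23 τ γ γ v x F)) i j k =
      rAct23 τ γ 0 v x (rAct13 τ γ γ w x (rAct12 τ γ 0 u x F)) i j k := by
  have hw' : w = v + u := by rw [hw, add_comm]
  by_cases hij : i = j
  · subst hij
    by_cases hik : i = k
    · subst hik
      simp [rAct12, rAct13, rAct23, rAct]
    · have hki : k ≠ i := Ne.symm hik
      have h1 := hx i k hik
      have h2 := hx' k i hki
      simp only [rAct12, rAct13, rAct23, rAct, dynDiff, hik, hki, if_true, if_false, sub_zero,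
        add_zero]
      rw [← neg_sub (x i) (x k)] at h2 ⊢
      generalize x i - x k = m at *
      have h3 : theta τ (m - γ) ≠ 0 := by
        rwa [show -m + γ = -(m - γ) by ring, theta_neg, neg_ne_zero] at h2
      have e1 := alphaF_mul_comm τ γ w v m (m - γ)
      have e2 := alphaF_mul_betaF_shift hτ hw rfl rfl hu hv hw0 h1 h3
      have e3 := betaF_shift hτ hw rfl rfl hu hv hw0 h1 h3
      linear_combination F i i k * e1 + F i k i * e2 + F k i i * e3
  · have hji : j ≠ i := Ne.symm hij
    by_cases hjk : j = k
    · subst hjk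
      have h1 := hx i j hij
      have h2 := hx' i j hij
      simp only [rAct12, rAct13, rAct23, rAct, dynDiff, hij, hji, if_true, if_false, sub_zero,
        add_zero]
      rw [← neg_sub (x i) (x j)]
      generalize x i - x j = m at *
      have e1 := alphaF_mul_comm τ γ u w (m + γ) m
      have e2 := alphaF_mul_betaF_shift (m := m + γ) (p := m) (q := -m - γ) hτ hw' (by ring)
        (by ring) hv hu hw0 h2 h1
      have e3 := betaF_shift (m := m + γ) (p := m) (q := -m - γ) hτ hw' (by ring)
        (by ring) hv hu hw0 h2 h1
      linear_combination F i j j * e1 - F j i j * e2 - F j j i * e3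
    · have hkj : k ≠ j := Ne.symm hjk
      by_cases hik : i = k
      · subst hik
        have h1 := hx i j hij
        have h2 := hx' j i hji
        simp only [rAct12, rAct13, rAct23, rAct, dynDiff, hij, hji, if_true, if_false, sub_zero,
          add_zero]
        rw [← neg_sub (x i) (x j)] at h2 ⊢
        generalize x i - x j = m at *
        have h3 : theta τ (m - γ) ≠ 0 := by
          rwa [show -m + γ = -(m - γ) by ring, theta_neg, neg_ne_zero] at h2
        have h4 : theta τ (-m) ≠ 0 := by rwa [theta_neg, neg_ne_zero]
        have e1 := alphaF_betaF_four_term_shift (p := m - γ) (s := -m + γ) hτ hw rfl rfl (by ring)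
          hu hv hw0 h1 h3 hγ
        have e2 := alphaF_mul_betaF_shift' (m := m - γ) (p := -m) (q := -m + γ) hτ hw (by ring)
          (by ring) hu hv hw0 h3 h4
        have e3 := alphaF_mul_betaF_shift' (m := -m) (p := m - γ) (q := m) hτ hw' (by ring)
          (by ring) hv hu hw0 h4 h3
        linear_combination F i j i * e1 - F i i j * e2 + F j i i * e3
      · have hki : k ≠ i := Ne.symm hik
        have h1 := hx i j hij
        have h2 := hx j k hjk
        have h3 := hx i k hik
        simp only [rAct12, rAct13, rAct23, rAct, dynDiff, hij, hji, hik, hki, hjk, hkj, if_false,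
          sub_zero, add_zero]
        rw [← neg_sub (x i) (x j), ← neg_sub (x j) (x k)]
        have hs : x i - x k = (x i - x j) + (x j - x k) := by ring
        generalize x i - x k = s at *
        generalize x i - x j = m at *
        generalize x j - x k = n at *
        have e1 := alphaF_mul_comm τ γ w v n s
        have e2 := alphaF_mul_comm τ γ u w m s
        have e3 := alphaF_betaF_three_term (q := -m) hτ hw hs rfl hu hv hw0 h1 h2 h3
        have e4 := alphaF_betaF_three_term (m := n) (n := m) (q := -n) hτ hw' (by rw [hs]; ring)
          rfl hv hu hw0 h2 h1 h3
        have e5 := alphaF_betaF_four_term (q := -m) (p := -n) hτ hw hs rfl rfl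
          hu hv hw0 h1 h2 h3
        linear_combination F j i k * betaF τ γ u m * e1 + F i k j * betaF τ γ v n * e2 +
          F k i j * e3 - F j k i * e4 + F k j i * e5

/-- `R(z, λ - γ ∑_{c ∈ S} h^{(c)})^{(ab)}` as an operation on the coordinates of a vector. -/
lemma Rop_mulVec {N n : ℕ} (τ γ z : ℂ) (lam : Fin N → ℂ) {S : Finset (Fin n)} {a b : Fin n}
    (ha : a ∉ S) (hb : b ∉ S) (v : (Fin n → Fin N) → ℂ) (f : Fin n → Fin N) :
    (Rop N n τ γ z lam S a b *ᵥ v) f =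
      rAct τ γ z (shiftL γ lam S f (f a) - shiftL γ lam S f (f b)) (f a) (f b) (v f)
        (v (f ∘ Equiv.swap a b)) := by
  have hshift : ∀ g : Fin n → Fin N, (∀ c, c ≠ a → c ≠ b → f c = g c) →
      shiftL γ lam S g = shiftL γ lam S f := by
    intro g hg
    funext i
    have : (S.filter fun c => g c = i) = S.filter fun c => f c = i :=
      Finset.filter_congr fun c hc => by
        rw [hg c (ne_of_mem_of_not_mem hc ha) (ne_of_mem_of_not_mem hc hb)]
    rw [shiftL, shiftL, this]
  have heq : ∀ g : Fin n → Fin N, g = f ↔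
      (∀ c, c ≠ a → c ≠ b → f c = g c) ∧ (g a, g b) = (f a, f b) := by
    intro g
    constructor
    · rintro rfl
      simp
    · rintro ⟨h, h'⟩
      rw [Prod.mk.injEq] at h'
      funext c
      by_cases hca : c = a
      · rw [hca, h'.1]
      · by_cases hcb : c = b
        · rw [hcb, h'.2]
        · exact (h c hca hcb).symm
  have hswap : ∀ g : Fin n → Fin N, g = f ∘ Equiv.swap a b ↔
      (∀ c, c ≠ a → c ≠ b → f c = g c) ∧ (g a, g b) = (f b, f a) := by
    intro g
    constructor
    · rintro rfl
      refine ⟨fun c hca hcb => ?_, ?_⟩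
      · simp [Equiv.swap_apply_of_ne_of_ne hca hcb]
      · simp
    · rintro ⟨h, h'⟩
      rw [Prod.mk.injEq] at h'
      funext c
      by_cases hca : c = a
      · simp [hca, h'.1]
      · by_cases hcb : c = b
        · simp [hcb, h'.2]
        · simp [Equiv.swap_apply_of_ne_of_ne hca hcb, h c hca hcb]
  have hentry : ∀ g : Fin n → Fin N, Rop N n τ γ z lam S a b f g =
      if f a = f b then (if g = f then 1 else 0) else
        (if g = f then alphaF τ γ z (shiftL γ lam S f (f a) - shiftL γ lam S f (f b)) else 0) +
        (if g = f ∘ Equiv.swap a b then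
          betaF τ γ z (shiftL γ lam S f (f a) - shiftL γ lam S f (f b)) else 0) := by
    intro g
    rw [Rop]
    simp only [heq g, hswap g]
    by_cases h : ∀ c, c ≠ a → c ≠ b → f c = g c
    · rw [if_pos h, hshift g h, Rmat]
      simp only [and_iff_right h]
    · simp only [h, if_false, false_and]
      simp
  simp only [Matrix.mulVec, dotProduct, hentry, rAct]
  by_cases h : f a = f b
  · simp [h]
  · simp [h, add_mul, Finset.sum_add_distrib]

lemma matrix_ext_mulVec {ι : Type*} [Fintype ι] [DecidableEq ι] {A B : Matrix ι ι ℂ}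
    (h : ∀ v f, (A *ᵥ v) f = (B *ᵥ v) f) : A = B :=
  Matrix.ext_of_mulVec_single fun _ => funext fun f => h _ f

/-- `R`-matrices acting on disjoint pairs of factors commute. -/
lemma Rop_commute {N n : ℕ} (τ γ z z' : ℂ) (lam : Fin N → ℂ) {S T : Finset (Fin n)}
    {a b c d : Fin n} (hac : a ≠ c) (had : a ≠ d) (hbc : b ≠ c)
    (hbd : b ≠ d) (ha : a ∉ S) (hb : b ∉ S) (hc : c ∉ T) (hd : d ∉ T) (hS : c ∈ S ↔ d ∈ S)
    (hT : a ∈ T ↔ b ∈ T) :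
    Commute (Rop N n τ γ z lam S a b) (Rop N n τ γ z' lam T c d) := by
  have hcard : ∀ (S : Finset (Fin n)) (c d : Fin n), (c ∈ S ↔ d ∈ S) →
      ∀ f : Fin n → Fin N, shiftL γ lam S (f ∘ Equiv.swap c d) = shiftL γ lam S f := by
    intro S c d hS f
    funext r
    have : (S.filter fun e => (f ∘ Equiv.swap c d) e = r).card =
        (S.filter fun e => f e = r).card := by
      refine Finset.card_bij' (fun e _ => Equiv.swap c d e) (fun e _ => Equiv.swap c d e)
        ?_ ?_ ?_ ?_
      · intro e he
        simp only [Finset.mem_filter, Function.comp_apply] at he ⊢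
        refine ⟨?_, he.2⟩
        rcases eq_or_ne e c with rfl | hec
        · simpa using hS.1 he.1
        · rcases eq_or_ne e d with rfl | hed
          · simpa using hS.2 he.1
          · simpa [Equiv.swap_apply_of_ne_of_ne hec hed] using he.1
      · intro e he
        simp only [Finset.mem_filter, Function.comp_apply] at he ⊢
        refine ⟨?_, by simpa using he.2⟩
        rcases eq_or_ne e c with rfl | hec
        · simpa using hS.1 he.1
        · rcases eq_or_ne e d with rfl | hed
          · simpa using hS.2 he.1
          · simpa [Equiv.swap_apply_of_ne_of_ne hec hed] using he.1
      · simp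
      · simp
    rw [shiftL, shiftL, this]
  refine matrix_ext_mulVec fun v f => ?_
  rw [← Matrix.mulVec_mulVec, ← Matrix.mulVec_mulVec, Rop_mulVec _ _ _ _ ha hb,
    Rop_mulVec _ _ _ _ hc hd, Rop_mulVec _ _ _ _ hc hd, Rop_mulVec _ _ _ _ hc hd,
    Rop_mulVec _ _ _ _ ha hb, Rop_mulVec _ _ _ _ ha hb, hcard S c d hS, hcard T a b hT]
  have hswap : (f ∘ Equiv.swap a b) ∘ Equiv.swap c d = (f ∘ Equiv.swap c d) ∘ Equiv.swap a b := by
    funext e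
    simp only [Function.comp_apply, Equiv.swap_apply_def]
    grind
  simp only [hswap, Function.comp_apply, Equiv.swap_apply_of_ne_of_ne hac had,
    Equiv.swap_apply_of_ne_of_ne hbc hbd, Equiv.swap_apply_of_ne_of_ne hac.symm hbc.symm,
    Equiv.swap_apply_of_ne_of_ne had.symm hbd.symm, rAct]
  split_ifs <;> ring

/-- The dynamical Yang–Baxter equation for the factors `a`, `b`, `c` of a tensor power. -/
lemma Rop_yangBaxter {N n : ℕ} {τ γ u v w : ℂ} (hτ : 0 < τ.im) (hw : w = u + v)
    (hu : theta τ (u - γ) ≠ 0) (hv : theta τ (v - γ) ≠ 0) (hw0 : theta τ (w - γ) ≠ 0)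
    (hγ : theta τ γ ≠ 0) (lam : Fin N → ℂ)
    (hlam : ∀ i j, i ≠ j → ∀ m : ℤ, |m| ≤ n + 1 → theta τ (lam i - lam j + m * γ) ≠ 0)
    {S : Finset (Fin n)} {a b c : Fin n} (hab : a ≠ b) (hac : a ≠ c) (hbc : b ≠ c)
    (ha : a ∉ S) (hb : b ∉ S) (hc : c ∉ S) :
    Rop N n τ γ u lam (insert c S) a b * Rop N n τ γ w lam S a c *
        Rop N n τ γ v lam (insert a S) b c =
      Rop N n τ γ v lam S b c * Rop N n τ γ w lam (insert b S) a c *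
        Rop N n τ γ u lam S a b := by
  refine matrix_ext_mulVec fun V f => ?_
  set P : Fin N → Fin N → Fin N → Fin n → Fin N := fun i j k e =>
    if e = a then i else if e = b then j else if e = c then k else f e with hP
  have hPa : ∀ i j k, P i j k a = i := by simp [hP]
  have hPb : ∀ i j k, P i j k b = j := by simp [hP, hab.symm]
  have hPc : ∀ i j k, P i j k c = k := by simp [hP, hac.symm, hbc.symm]
  have hPf : f = P (f a) (f b) (f c) := by
    funext e
    simp only [hP]
    split_ifs with h1 h2 h3
    exacts [h1 ▸ rfl, h2 ▸ rfl, h3 ▸ rfl, rfl]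
  have hPab : ∀ i j k, P i j k ∘ Equiv.swap a b = P j i k := by
    intro i j k
    funext e
    simp only [hP, Function.comp_apply, Equiv.swap_apply_def]
    grind
  have hPac : ∀ i j k, P i j k ∘ Equiv.swap a c = P k j i := by
    intro i j k
    funext e
    simp only [hP, Function.comp_apply, Equiv.swap_apply_def]
    grind
  have hPbc : ∀ i j k, P i j k ∘ Equiv.swap b c = P i k j := by
    intro i j k
    funext e
    simp only [hP, Function.comp_apply, Equiv.swap_apply_def]
    grind
  set x := shiftL γ lam S f with hx
  have hshift : ∀ i j k, shiftL γ lam S (P i j k) = x := by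
    intro i j k
    funext e
    have : (S.filter fun e' => P i j k e' = e) = S.filter fun e' => f e' = e :=
      Finset.filter_congr fun e' he' => by
        simp [hP, ne_of_mem_of_not_mem he' ha, ne_of_mem_of_not_mem he' hb,
          ne_of_mem_of_not_mem he' hc]
    rw [hx, shiftL, shiftL, this]
  have hins : ∀ d, d ∉ S → ∀ i j k e, shiftL γ lam (insert d S) (P i j k) e =
      x e - if P i j k d = e then γ else 0 := by
    intro d hd i j k e
    rw [← hshift i j k, shiftL, shiftL, Finset.filter_insert]
    split_ifs
    · rw [Finset.card_insert_of_notMem (by simp [hd])]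
      push_cast
      ring
    · ring
  have hdiff : ∀ i j, ∃ m : ℤ, |m| ≤ n ∧ x i - x j = lam i - lam j + m * γ := by
    intro i j
    refine ⟨((S.filter fun e => f e = j).card : ℤ) - (S.filter fun e => f e = i).card, ?_, ?_⟩
    · have h1 := (Finset.card_filter_le S fun e => f e = j).trans (Finset.card_le_univ S)
      have h2 := (Finset.card_filter_le S fun e => f e = i).trans (Finset.card_le_univ S)
      rw [Fintype.card_fin] at h1 h2
      rw [abs_le]
      constructor <;> omega
    · simp only [hx, shiftL]
      push_cast
      ring
  have hx0 : ∀ i j, i ≠ j → theta τ (x i - x j) ≠ 0 := by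
    intro i j hij
    obtain ⟨m, hm, h⟩ := hdiff i j
    rw [h]
    exact hlam i j hij m (by omega)
  have hx1 : ∀ i j, i ≠ j → theta τ (x i - x j + γ) ≠ 0 := by
    intro i j hij
    obtain ⟨m, hm, h⟩ := hdiff i j
    have := hlam i j hij (m + 1) (by rw [abs_le] at *; omega)
    rw [h]
    convert this using 2
    push_cast
    ring
  have i1 : ∀ {d e : Fin n}, d ≠ e → d ∉ S → d ∉ insert e S := by
    intro d e hde hd
    simp [hde, hd]
  suffices h : ∀ i j k, ((Rop N n τ γ u lam (insert c S) a b * Rop N n τ γ w lam S a c *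
        Rop N n τ γ v lam (insert a S) b c) *ᵥ V) (P i j k) =
      ((Rop N n τ γ v lam S b c * Rop N n τ γ w lam (insert b S) a c *
        Rop N n τ γ u lam S a b) *ᵥ V) (P i j k) by
    have := h (f a) (f b) (f c)
    rwa [← hPf] at this
  intro i j k
  have key := rAct_yangBaxter hτ hw hu hv hw0 hγ x hx0 hx1 (fun i j k => V (P i j k)) i j k
  clear hPf
  clear_value P x
  simp only [← Matrix.mulVec_mulVec]
  simp only [Rop_mulVec _ _ _ _ ha hb, Rop_mulVec _ _ _ _ ha hc,
    Rop_mulVec _ _ _ _ hb hc, Rop_mulVec _ _ _ _ (i1 hac ha) (i1 hbc hb),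
    Rop_mulVec _ _ _ _ (i1 hab ha) (i1 hbc.symm hc),
    Rop_mulVec _ _ _ _ (i1 hab.symm hb) (i1 hac.symm hc), hPa, hPb, hPc, hPab, hPac, hPbc,
    hshift, hins _ ha, hins _ hb, hins _ hc]
  have hd : ∀ s k i j, x i - (if k = i then s else 0) - (x j - if k = j then s else 0) =
      dynDiff x s k i j := by
    intro s k i j
    rw [dynDiff]
    ring
  simp only [hd]
  simp only [rAct12, rAct13, rAct23] at key
  simpa [dynDiff] using key

section Fusion

variable {ι M : Type*} [DecidableEq ι] [Monoid M]

/-- The algebraic properties of `R S a b = R(z_a - z_b, λ - γ ∑_{c ∈ S} h^{(c)})^{(ab)}`: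
operators on disjoint pairs of factors commute, and the dynamical Yang–Baxter equation holds for
triples of factors that are pairwise related by `P`. -/
structure IsDynamicalYangBaxter (R : Finset ι → ι → ι → M) (P : ι → ι → Prop) : Prop where
  commute : ∀ {S T : Finset ι} {a b c d : ι}, a ≠ c → a ≠ d → b ≠ c → b ≠ d →
    a ∉ S → b ∉ S → c ∉ T → d ∉ T → (c ∈ S ↔ d ∈ S) → (a ∈ T ↔ b ∈ T) →
    Commute (R S a b) (R T c d)
  yangBaxter : ∀ {S : Finset ι} {a b c : ι}, P a b → P a c → P b c →
    a ≠ b → a ≠ c → b ≠ c → a ∉ S → b ∉ S → c ∉ S →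
    R (insert c S) a b * R S a c * R (insert a S) b c =
      R S b c * R (insert b S) a c * R S a b

/-- The product `R^{(a p_1)} R^{(a p_2)} ⋯` over a list of factors `p_1, p_2, …`, where each
operator is shifted by the weights of `S` and of the later factors of the list. -/
def fusedL (R : Finset ι → ι → ι → M) (a : ι) : List ι → Finset ι → M
  | [], _ => 1
  | p :: l, S => R (S ∪ l.toFinset) a p * fusedL R a l S

/-- The product `⋯ R^{(a p_2)} R^{(a p_1)}` over a list of factors `p_1, p_2, …`, where each
operator is shifted by the weights of `S` and of the earlier factors of the list. -/
def fusedL' (R : Finset ι → ι → ι → M) (a : ι) : List ι → Finset ι → M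
  | [], _ => 1
  | p :: l, S => fusedL' R a l (insert p S) * R S a p

/-- The operator `W` for a list of factors, shifted by the weights of `S`. -/
def fusedW (R : Finset ι → ι → ι → M) : List ι → Finset ι → M
  | [], _ => 1
  | p :: l, S => fusedL R p l S * fusedW R l (insert p S)

namespace IsDynamicalYangBaxter

variable {R : Finset ι → ι → ι → M} {P : ι → ι → Prop}

lemma commute_fusedL (hR : IsDynamicalYangBaxter R P)
    {S T : Finset ι} {a c d : ι} {l : List ι} (hal : (a :: l).Nodup)
    (hc : c ∉ a :: l) (hd : d ∉ a :: l) (hcT : c ∉ T) (hdT : d ∉ T) (hcd : c ∈ S ↔ d ∈ S)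
    (hS : ∀ x ∈ a :: l, x ∉ S) (hT : ∀ x ∈ l, a ∈ T ↔ x ∈ T) :
    Commute (R T c d) (fusedL R a l S) := by
  induction l with
  | nil => exact Commute.one_right _
  | cons p l ih =>
    simp only [List.nodup_cons, List.mem_cons, not_or, forall_eq_or_imp] at *
    obtain ⟨⟨hap, hal⟩, hpl, hl⟩ := hal
    obtain ⟨hca, hcp, hcl⟩ := hc
    obtain ⟨hda, hdp, hdl⟩ := hd
    refine Commute.mul_right ?_ (ih ⟨hal, hl⟩ ⟨hca, hcl⟩ ⟨hda, hdl⟩ ⟨hS.1, hS.2.2⟩ hT.2)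
    refine hR.commute hca hcp hda hdp hcT hdT ?_ ?_ ?_ ?_
    · simp [hal, hS]
    · simp [hpl, hS]
    · exact hT.1
    · simp [hcl, hdl, hcd]

lemma commute_fusedW (hR : IsDynamicalYangBaxter R P)
    {S T : Finset ι} {c d : ι} {l : List ι} (hl : l.Nodup)
    (hc : c ∉ l) (hd : d ∉ l) (hcT : c ∉ T) (hdT : d ∉ T) (hcd : c ∈ S ↔ d ∈ S)
    (hS : ∀ x ∈ l, x ∉ S) (hT : ∀ x ∈ l, x ∉ T) :
    Commute (R T c d) (fusedW R l S) := by
  induction l generalizing S with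
  | nil => exact Commute.one_right _
  | cons p l ih =>
    refine Commute.mul_right (hR.commute_fusedL hl hc hd hcT hdT hcd hS fun x hx => ?_) ?_
    · exact iff_of_false (hT p (by simp)) (hT x (by simp [hx]))
    · simp only [List.nodup_cons, List.mem_cons, not_or, forall_eq_or_imp] at *
      refine ih hl.2 hc.2 hd.2 (by simp [hc.1, hd.1, hcd]) (fun x hx => ?_) hT.2
      simp [hS.2 x hx, ne_of_mem_of_not_mem hx hl.1]

lemma fusedL_mul_fusedL (hR : IsDynamicalYangBaxter R P)
    {S : Finset ι} {a p : ι} {l : List ι} (hl : (a :: p :: l).Nodup)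
    (hP : (a :: p :: l).Pairwise P) (hS : ∀ x ∈ a :: p :: l, x ∉ S) :
    fusedL R a (p :: l) S * fusedL R p l (insert a S) =
      fusedL R p l S * fusedL R a l (insert p S) * R S a p := by
  induction l with
  | nil => simp [fusedL]
  | cons q l ih =>
    simp only [List.nodup_cons, List.pairwise_cons, List.mem_cons, not_or, forall_eq_or_imp] at *
    obtain ⟨⟨hap, haq, hal⟩, ⟨hpq, hpl⟩, hql, hl⟩ := hl
    obtain ⟨⟨Pap, Paq, Pal⟩, ⟨Ppq, Ppl⟩, Pql, Pl⟩ := hP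
    obtain ⟨haS, hpS, hqS, hlS⟩ := hS
    have ih := ih ⟨⟨hap, hal⟩, hpl, hl⟩ ⟨⟨Pap, Pal⟩, Ppl, Pl⟩ ⟨haS, hpS, hlS⟩
    have c1 : Commute (R (insert a S ∪ l.toFinset) p q) (fusedL R a l S) :=
      hR.commute_fusedL (by simp [hal, hl]) (by simp [Ne.symm hap, hpl])
        (by simp [Ne.symm haq, hql]) (by simp [Ne.symm hap, hpS, hpl])
        (by simp [Ne.symm haq, hqS, hql]) (by simp [hpS, hqS]) (by simpa [haS] using hlS)
        (by simp +contextual)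
    have c2 : Commute (R (insert p S ∪ l.toFinset) a q) (fusedL R p l S) :=
      hR.commute_fusedL (by simp [hpl, hl]) (by simp [hap, hal])
        (by simp [Ne.symm hpq, hql]) (by simp [hap, haS, hal])
        (by simp [Ne.symm hpq, hqS, hql]) (by simp [haS, hqS]) (by simpa [hpS] using hlS)
        (by simp +contextual)
    have yb := hR.yangBaxter (S := S ∪ l.toFinset) Pap Paq Ppq hap haq hpq (by simp [haS, hal])
      (by simp [hpS, hpl]) (by simp [hqS, hql])
    simp only [fusedL, List.toFinset_cons, Finset.insert_union, Finset.union_insert] at *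
    calc R (insert q (S ∪ l.toFinset)) a p * (R (S ∪ l.toFinset) a q * fusedL R a l S) *
          (R (insert a (S ∪ l.toFinset)) p q * fusedL R p l (insert a S))
        = R (insert q (S ∪ l.toFinset)) a p * R (S ∪ l.toFinset) a q *
          (fusedL R a l S * R (insert a (S ∪ l.toFinset)) p q) * fusedL R p l (insert a S) := by
          simp only [mul_assoc]
      _ = R (insert q (S ∪ l.toFinset)) a p * R (S ∪ l.toFinset) a q *
          R (insert a (S ∪ l.toFinset)) p q * (fusedL R a l S * fusedL R p l (insert a S)) := by
          rw [← c1.eq]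
          simp only [mul_assoc]
      _ = R (S ∪ l.toFinset) p q * R (insert p (S ∪ l.toFinset)) a q *
          (R (S ∪ l.toFinset) a p * fusedL R a l S * fusedL R p l (insert a S)) := by
          rw [yb]
          simp only [mul_assoc]
      _ = R (S ∪ l.toFinset) p q * (R (insert p (S ∪ l.toFinset)) a q * fusedL R p l S) *
          (fusedL R a l (insert p S) * R S a p) := by
          rw [ih]
          simp only [mul_assoc]
      _ = _ := by
          rw [c2.eq]
          simp only [mul_assoc]

/-- The intertwining relation between the two orders of fusion. -/
lemma fusedL_mul_fusedW (hR : IsDynamicalYangBaxter R P)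
    {S : Finset ι} {a : ι} {l : List ι} (hl : (a :: l).Nodup)
    (hP : (a :: l).Pairwise P) (hS : ∀ x ∈ a :: l, x ∉ S) :
    fusedL R a l S * fusedW R l (insert a S) = fusedW R l S * fusedL' R a l S := by
  induction l generalizing S with
  | nil => simp [fusedL, fusedW, fusedL']
  | cons p l ih =>
    have key := hR.fusedL_mul_fusedL hl hP hS
    simp only [List.nodup_cons, List.pairwise_cons, List.mem_cons, not_or, forall_eq_or_imp] at *
    obtain ⟨⟨hap, hal⟩, hpl, hl⟩ := hl
    obtain ⟨⟨Pap, Pal⟩, Ppl, Pl⟩ := hP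
    obtain ⟨haS, hpS, hlS⟩ := hS
    have hlp : ∀ x ∈ l, x ∉ insert p S := by
      intro x hx
      simp [hlS x hx, ne_of_mem_of_not_mem hx hpl]
    have ih := ih (S := insert p S) ⟨hal, hl⟩ ⟨Pal, Pl⟩ ⟨by simp [hap, haS], hlp⟩
    have c := hR.commute_fusedW (S := insert a (insert p S)) (T := S) hl hal hpl haS hpS
      (by simp) (by
        intro x hx
        simp only [Finset.mem_insert, not_or]
        exact ⟨ne_of_mem_of_not_mem hx hal, by simpa using hlp x hx⟩) hlS
    simp only [fusedW, fusedL']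
    rw [← mul_assoc, key, Finset.insert_comm p a, mul_assoc, c.eq, ← mul_assoc,
      mul_assoc (fusedL R p l S), ih]
    simp only [mul_assoc]

end IsDynamicalYangBaxter

end Fusion

section FusionMap

variable {ι ι' M M' : Type*} [DecidableEq ι] [DecidableEq ι'] [Monoid M] [Monoid M']
  {R : Finset ι → ι → ι → M} {R' : Finset ι' → ι' → ι' → M'} {T : Finset ι'}

lemma map_fusedL (φ : M →* M') (e : ι ↪ ι')
    (h : ∀ S a b, φ (R S a b) = R' (T ∪ S.map e) (e a) (e b)) (a : ι) (l : List ι)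
    (S : Finset ι) : φ (fusedL R a l S) = fusedL R' (e a) (l.map e) (T ∪ S.map e) := by
  induction l with
  | nil => exact map_one φ
  | cons p l ih =>
    have hl : (l.map e).toFinset = l.toFinset.map e := by
      ext
      simp
    rw [List.map_cons, fusedL, fusedL, map_mul, ih, h, Finset.map_union, Finset.union_assoc, hl]

lemma map_fusedW (φ : M →* M') (e : ι ↪ ι')
    (h : ∀ S a b, φ (R S a b) = R' (T ∪ S.map e) (e a) (e b)) (l : List ι)
    (S : Finset ι) : φ (fusedW R l S) = fusedW R' (l.map e) (T ∪ S.map e) := by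
  induction l generalizing S with
  | nil => exact map_one φ
  | cons p l ih =>
    rw [List.map_cons, fusedW, fusedW, map_mul, ih, map_fusedL φ e h, Finset.map_insert,
      Finset.union_insert]

lemma fusedW_apply {κ : Type*} (R : κ → Finset ι → ι → ι → M) (l : List ι) (S : Finset ι)
    (k : κ) : fusedW (fun S a b k => R k S a b) l S k = fusedW (R k) l S := by
  have := map_fusedW (R := fun S a b k => R k S a b) (R' := R k) (T := ∅)
    (Pi.evalMonoidHom (fun _ : κ => M) k) (Function.Embedding.refl ι) (by simp) l S
  rwa [Finset.map_refl, Finset.empty_union, Function.Embedding.coe_refl, List.map_id] at this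

lemma fusedL_eq_prod {m : ℕ} (R : Finset (Fin m) → Fin m → Fin m → M) (a : Fin m)
    {l : List (Fin m)} (hl : l.Pairwise (· < ·)) (hup : ∀ p ∈ l, ∀ c, p < c → c ∈ l) :
    fusedL R a l ∅ = (l.map fun p => R (Finset.univ.filter fun c => p < c) a p).prod := by
  induction l with
  | nil => rfl
  | cons p l ih =>
    rw [List.pairwise_cons] at hl
    have h : Finset.univ.filter (fun c => p < c) = l.toFinset := by
      ext c
      simp only [Finset.mem_filter, Finset.mem_univ, true_and, List.mem_toFinset]
      refine ⟨fun hc => ?_, hl.1 c⟩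
      exact (List.mem_cons.1 (hup p (by simp) c hc)).resolve_left hc.ne'
    rw [fusedL, List.map_cons, List.prod_cons, h, Finset.empty_union, ih hl.2]
    intro q hq c hc
    exact (List.mem_cons.1 (hup q (by simp [hq]) c hc)).resolve_left ((hl.1 q hq).trans hc).ne'

lemma fusedL'_eq_prod {m : ℕ} (R : Finset (Fin (m + 1)) → Fin (m + 1) → Fin (m + 1) → M)
    (a : Fin (m + 1)) {l : List (Fin (m + 1))} {S : Finset (Fin (m + 1))}
    (hl : l.Pairwise (· < ·)) (h : ∀ p ∈ l, ∀ c, 0 < c ∧ c < p ↔ c ∈ S ∨ c ∈ l ∧ c < p) :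
    fusedL' R a l S =
      (l.reverse.map fun p => R (Finset.univ.filter fun c => 0 < c ∧ c < p) a p).prod := by
  induction l generalizing S with
  | nil => rfl
  | cons p l ih =>
    rw [List.pairwise_cons] at hl
    have hS : Finset.univ.filter (fun c => 0 < c ∧ c < p) = S := by
      ext c
      simp only [Finset.mem_filter, Finset.mem_univ, true_and, h p (by simp) c]
      refine or_iff_left ?_
      rintro ⟨hc, hcp⟩
      rcases List.mem_cons.1 hc with rfl | hc
      · exact hcp.false
      · exact (hl.1 c hc).asymm hcp
    rw [fusedL', List.reverse_cons, List.map_append, List.prod_append, List.map_singleton,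
      List.prod_singleton, hS, ih hl.2]
    intro q hq c
    rw [h q (by simp [hq]) c, Finset.mem_insert, List.mem_cons]
    have := hl.1 q hq
    constructor
    · rintro (h | ⟨h | h, h'⟩) <;> simp [*]
    · rintro ((h | h) | h)
      · simp [h, this]
      · simp [h]
      · simp [h]

end FusionMap

/-- `M ↦ Id ⊗ M(λ - γ h^{(0)})` as a monoid homomorphism. -/
def idTensorShiftHom (N n : ℕ) (γ : ℂ) (lam : Fin N → ℂ) :
    ((Fin N → ℂ) → Matrix (Fin n → Fin N) (Fin n → Fin N) ℂ) →*
      Matrix (Fin (n + 1) → Fin N) (Fin (n + 1) → Fin N) ℂ where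
  toFun M := idTensorShift N n γ M lam
  map_one' := by
    ext f g
    have h : f = g ↔ f 0 = g 0 ∧ Fin.tail f = Fin.tail g := by
      rw [← Fin.cons_self_tail f, ← Fin.cons_self_tail g, Fin.cons_inj]
      simp
    simp only [idTensorShift, Matrix.of_apply, Pi.one_apply, Matrix.one_apply, h, ite_and]
  map_mul' A B := by
    ext f g
    simp only [idTensorShift, Matrix.of_apply, Pi.mul_apply, Matrix.mul_apply]
    have ht : ∀ i x, Fin.tail (Fin.consEquiv (fun _ : Fin (n + 1) => Fin N) (i, x)) = x :=
      fun _ _ => rfl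
    rw [← (Fin.consEquiv fun _ => Fin N).sum_comp, Fintype.sum_prod_type]
    simp only [ht, Fin.consEquiv_apply, Fin.cons_zero]
    rw [Finset.sum_eq_single (g 0)]
    · simp
    · intro i _ hi
      simp [hi]
    · simp

lemma shiftL_map_succ {N n : ℕ} (γ : ℂ) (lam : Fin N → ℂ) (S : Finset (Fin n))
    (g : Fin (n + 1) → Fin N) :
    shiftL γ lam (S.map (Fin.succEmb n)) g = shiftL γ lam S (Fin.tail g) := by
  funext i
  rw [shiftL, shiftL, Finset.filter_map, Finset.card_map]
  rfl

lemma shiftL_insert_zero {N n : ℕ} (γ : ℂ) (lam : Fin N → ℂ) (S : Finset (Fin n))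
    (g : Fin (n + 1) → Fin N) :
    shiftL γ lam ({0} ∪ S.map (Fin.succEmb n)) g =
      shiftL γ (fun i => lam i - if g 0 = i then γ else 0) S (Fin.tail g) := by
  funext i
  have h : (0 : Fin (n + 1)) ∉ (S.map (Fin.succEmb n)).filter fun c => g c = i := by
    simp [Fin.succ_ne_zero]
  have h' := congrFun (shiftL_map_succ γ lam S g) i
  simp only [shiftL] at h' ⊢
  rw [← Finset.insert_eq, Finset.filter_insert]
  split_ifs with hg
  · rw [Finset.card_insert_of_notMem h]
    push_cast
    linear_combination h'
  · linear_combination h'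

lemma idTensorShift_Rop {N n : ℕ} (τ γ z : ℂ) (lam : Fin N → ℂ) (S : Finset (Fin n))
    (a b : Fin n) :
    idTensorShift N n γ (fun lam => Rop N n τ γ z lam S a b) lam =
      Rop N (n + 1) τ γ z lam ({0} ∪ S.map (Fin.succEmb n)) a.succ b.succ := by
  ext f g
  simp only [idTensorShift, Matrix.of_apply, Rop, shiftL_insert_zero, Fin.forall_fin_succ,
    Fin.succ_inj, ne_eq, ite_and, (Fin.succ_ne_zero _).symm, not_false_eq_true, forall_const]
  rfl

lemma idTensor_Rop {N n : ℕ} (τ γ z : ℂ) (lam : Fin N → ℂ) (S : Finset (Fin n))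
    (a b : Fin n) :
    idTensor N n (Rop N n τ γ z lam S a b) =
      Rop N (n + 1) τ γ z lam (S.map (Fin.succEmb n)) a.succ b.succ := by
  ext f g
  simp only [idTensor, Matrix.of_apply, Rop, shiftL_map_succ, Fin.forall_fin_succ,
    Fin.succ_inj, ne_eq, ite_and, (Fin.succ_ne_zero _).symm, not_false_eq_true, forall_const]
  rfl

lemma finRange_map_succ_pairwise (n : ℕ) :
    ((List.finRange n).map (Fin.succEmb n)).Pairwise (· < ·) :=
  (List.pairwise_lt_finRange n).map _ fun _ _ h => Fin.succ_lt_succ_iff.2 h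

lemma mem_finRange_map_succ {n : ℕ} (c : Fin (n + 1)) :
    c ∈ (List.finRange n).map (Fin.succEmb n) ↔ 0 < c := by
  refine Fin.cases (by simp) (fun i => ?_) c
  simp

/-- The operators `R(ζ_a - ζ_b, λ - γ ∑_{c ∈ S} h^{(c)})^{(ab)}`. -/
def RopAt (N m : ℕ) (τ γ : ℂ) (ζ : Fin m → ℂ) (lam : Fin N → ℂ) (S : Finset (Fin m))
    (a b : Fin m) : Matrix (Fin m → Fin N) (Fin m → Fin N) ℂ :=
  Rop N m τ γ (ζ a - ζ b) lam S a b

lemma fusedL_RopAt {N n : ℕ} (τ γ : ℂ) (ζ : Fin (n + 1) → ℂ) (lam : Fin N → ℂ) :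
    fusedL (RopAt N (n + 1) τ γ ζ lam) 0 ((List.finRange n).map (Fin.succEmb n)) ∅ =
      ((List.finRange n).map fun j : Fin n => Rop N (n + 1) τ γ (ζ 0 - ζ j.succ) lam
        (Finset.univ.filter fun c : Fin (n + 1) => j.succ < c) 0 j.succ).prod := by
  rw [fusedL_eq_prod _ _ (finRange_map_succ_pairwise n), List.map_map]
  · rfl
  · simp only [mem_finRange_map_succ]
    exact fun p hp c hc => hp.trans hc

lemma fusedL'_RopAt {N n : ℕ} (τ γ : ℂ) (ζ : Fin (n + 1) → ℂ) (lam : Fin N → ℂ) :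
    fusedL' (RopAt N (n + 1) τ γ ζ lam) 0 ((List.finRange n).map (Fin.succEmb n)) ∅ =
      (((List.finRange n).reverse).map fun j : Fin n =>
        Rop N (n + 1) τ γ (ζ 0 - ζ j.succ) lam
          (Finset.univ.filter fun c : Fin (n + 1) => 0 < c ∧ c < j.succ) 0 j.succ).prod := by
  rw [fusedL'_eq_prod _ _ (finRange_map_succ_pairwise n), ← List.map_reverse, List.map_map]
  · rfl
  · intro p _ c
    rw [mem_finRange_map_succ]
    simp

lemma idTensorShift_fusedW {N n : ℕ} (τ γ : ℂ) (ζ : Fin (n + 1) → ℂ) (lam : Fin N → ℂ) :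
    idTensorShift N n γ (fun lam => fusedW (RopAt N n τ γ (fun j => ζ j.succ) lam)
        (List.finRange n) ∅) lam =
      fusedW (RopAt N (n + 1) τ γ ζ lam) ((List.finRange n).map (Fin.succEmb n)) {0} := by
  have := map_fusedW (R := fun S a b lam => RopAt N n τ γ (fun j => ζ j.succ) lam S a b)
    (R' := RopAt N (n + 1) τ γ ζ lam) (T := {0}) (idTensorShiftHom N n γ lam) (Fin.succEmb n)
    (fun S a b => idTensorShift_Rop τ γ _ lam S a b) (List.finRange n) ∅
  rw [Finset.map_empty, Finset.union_empty] at this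
  rw [← this]
  exact congrArg (fun M => idTensorShift N n γ M lam)
    (funext fun lam => (fusedW_apply _ _ _ lam).symm)

lemma idTensor_fusedW {N n : ℕ} (τ γ : ℂ) (ζ : Fin (n + 1) → ℂ) (lam : Fin N → ℂ) :
    idTensor N n (fusedW (RopAt N n τ γ (fun j => ζ j.succ) lam) (List.finRange n) ∅) =
      fusedW (RopAt N (n + 1) τ γ ζ lam) ((List.finRange n).map (Fin.succEmb n)) ∅ := by
  have := map_fusedW (R := RopAt N n τ γ (fun j => ζ j.succ) lam)
    (R' := RopAt N (n + 1) τ γ ζ lam) (T := ∅)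
    ((idTensorShiftHom N n γ lam).comp (Pi.constMonoidHom (Fin N → ℂ) _)) (Fin.succEmb n)
    (fun S a b => by
      rw [Finset.empty_union]
      exact idTensor_Rop τ γ _ lam S a b) (List.finRange n) ∅
  rw [Finset.map_empty, Finset.union_empty] at this
  exact this

lemma Wrec_eq_fusedW {N : ℕ} (τ γ : ℂ) {n : ℕ} (ζ : Fin n → ℂ) (lam : Fin N → ℂ) :
    Wrec N τ γ n ζ lam = fusedW (RopAt N n τ γ ζ lam) (List.finRange n) ∅ := by
  induction n generalizing lam with
  | zero => rfl
  | succ n ih =>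
    have h := idTensorShift_fusedW τ γ ζ lam
    simp only [← ih] at h
    rw [List.finRange_succ, fusedW, insert_empty_eq]
    exact (congrArg₂ (· * ·) (fusedL_RopAt τ γ ζ lam) h.symm).symm

lemma isDynamicalYangBaxter_RopAt {N m : ℕ} {τ γ : ℂ} (hτ : 0 < τ.im) (ζ : Fin m → ℂ)
    (lam : Fin N → ℂ) (hγ : theta τ γ ≠ 0)
    (hlam : ∀ i j, i ≠ j → ∀ k : ℤ, |k| ≤ m + 1 → theta τ (lam i - lam j + k * γ) ≠ 0) :
    IsDynamicalYangBaxter (RopAt N m τ γ ζ lam) fun a b => theta τ (ζ a - ζ b - γ) ≠ 0 where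
  commute h1 h2 h3 h4 h5 h6 h7 h8 h9 h10 :=
    Rop_commute τ γ _ _ lam h1 h2 h3 h4 h5 h6 h7 h8 h9 h10
  yangBaxter hab hac hbc h1 h2 h3 h4 h5 h6 :=
    Rop_yangBaxter hτ (sub_add_sub_cancel _ _ _).symm hab hbc hac hγ lam hlam h1 h2 h3 h4 h5 h6

/-- The intertwining identity under explicit genericity conditions. -/
lemma Lop_mul_idTensorShift_WS {N n : ℕ} {τ γ z w : ℂ} (hτ : 0 < τ.im) {lam : Fin N → ℂ}
    (hzw : ∀ j : Fin n, theta τ (z - w - ((j : ℕ) + 1) * γ) ≠ 0)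
    (hγ : ∀ j : Fin (n + 1), theta τ (((j : ℕ) + 1) * γ) ≠ 0)
    (hlam : ∀ i j, i ≠ j → ∀ k ∈ Finset.Icc (-(n + 2) : ℤ) (n + 2),
      theta τ (lam i - lam j + k * γ) ≠ 0) :
    Lop N n τ γ z w lam * idTensorShift N n γ (WS N n τ γ) lam =
      idTensor N n (WS N n τ γ lam) * Lop' N n τ γ z w lam := by
  set ζ : Fin (n + 1) → ℂ := Fin.cons (z - w) fun j : Fin n => ((j : ℕ) : ℂ) * γ with hζ
  have hR := isDynamicalYangBaxter_RopAt (N := N) (γ := γ) hτ ζ lam (by simpa using hγ 0)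
    fun i j hij k hk => hlam i j hij k (by
      rw [Finset.mem_Icc]
      rw [abs_le] at hk
      push_cast at hk
      constructor <;> linarith)
  have key := hR.fusedL_mul_fusedW (S := ∅) (a := 0)
    (l := (List.finRange n).map (Fin.succEmb n)) ?_ ?_ (by simp)
  · rw [fusedL_RopAt, fusedL'_RopAt, insert_empty_eq, ← idTensorShift_fusedW,
      ← idTensor_fusedW] at key
    simp only [← Wrec_eq_fusedW] at key
    exact key
  · refine List.nodup_cons.2 ⟨by simp, ?_⟩
    exact (finRange_map_succ_pairwise n).imp fun h => h.ne
  · refine List.pairwise_cons.2 ⟨?_, ?_⟩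
    · intro c hc
      obtain ⟨j, -, rfl⟩ := List.mem_map.1 hc
      convert hzw j using 2
      simp [hζ]
      ring
    · refine (List.pairwise_lt_finRange n).map _ fun i j hij => ?_
      have h := hγ ⟨(j : ℕ) - i, by omega⟩
      have hij' : (i : ℕ) ≤ j := hij.le
      rw [← neg_ne_zero, ← theta_neg] at h
      convert h using 2
      simp [hζ, Nat.cast_sub hij']
      ring

lemma isOpen_dense_theta_comp_ne_zero {τ : ℂ} (hτ : 0 < τ.im) {E κ : Type*}
    [NormedAddCommGroup E] [NormedSpace ℂ E] [CompleteSpace E] [Finite κ] (φ : κ → E →L[ℂ] ℂ)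
    (hφ : ∀ k, ∃ x, φ k x ≠ 0) :
    IsOpen {x | ∀ k, theta τ (φ k x) ≠ 0} ∧ Dense {x | ∀ k, theta τ (φ k x) ≠ 0} := by
  have ho : ∀ k, IsOpen {x | theta τ (φ k x) ≠ 0} := fun k =>
    (isOpen_theta_ne_zero hτ).preimage (φ k).continuous
  rw [Set.ofPred_forall]
  refine ⟨isOpen_iInter_of_finite ho, dense_iInter_of_isOpen ho fun k => ?_⟩
  refine (dense_theta_ne_zero hτ).preimage ((φ k).isOpenMap ?_)
  refine LinearMap.surjective (f := (φ k : E →ₗ[ℂ] ℂ)) fun h => ?_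
  obtain ⟨x, hx⟩ := hφ k
  exact hx (LinearMap.congr_fun h x)

/-- `L(z,λ) (1 ⊗ W^S_n(λ-γh^{(0)})) = (1 ⊗ W^S_n(λ)) L'(z,λ)`. -/
theorem L_WS_intertwining (N : ℕ) (hN : 2 ≤ N) (τ : ℂ) (hτ : 0 < τ.im) (n : ℕ)
    (hn : 1 ≤ n) :
    ∃ U : Set (ℂ × ℂ × ℂ × (Fin N → ℂ)), IsOpen U ∧ Dense U ∧
      ∀ z w γ : ℂ, ∀ lam : Fin N → ℂ, (z, w, γ, lam) ∈ U →
        Lop N n τ γ z w lam * idTensorShift N n γ (WS N n τ γ) lam =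
          idTensor N n (WS N n τ γ lam) * Lop' N n τ γ z w lam := by
  let Z : (ℂ × ℂ × ℂ × (Fin N → ℂ)) →L[ℂ] ℂ :=
    ContinuousLinearMap.fst ℂ _ _
  let W : (ℂ × ℂ × ℂ × (Fin N → ℂ)) →L[ℂ] ℂ :=
    (ContinuousLinearMap.fst ℂ _ _).comp (ContinuousLinearMap.snd ℂ _ _)
  let G : (ℂ × ℂ × ℂ × (Fin N → ℂ)) →L[ℂ] ℂ :=
    (ContinuousLinearMap.fst ℂ _ _).comp
      ((ContinuousLinearMap.snd ℂ _ _).comp (ContinuousLinearMap.snd ℂ _ _))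
  let Λ (i : Fin N) : (ℂ × ℂ × ℂ × (Fin N → ℂ)) →L[ℂ] ℂ :=
    (ContinuousLinearMap.proj i).comp
    ((ContinuousLinearMap.snd ℂ _ _).comp
      ((ContinuousLinearMap.snd ℂ _ _).comp (ContinuousLinearMap.snd ℂ _ _)))
  obtain ⟨o1, d1⟩ := isOpen_dense_theta_comp_ne_zero hτ
    (fun j : Fin n => Z - W - (((j : ℕ) : ℂ) + 1) • G) fun _ =>
      ⟨(1, 0, 0, 0), by simp [Z, W, G]⟩
  obtain ⟨o2, d2⟩ := isOpen_dense_theta_comp_ne_zero hτ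
    (fun j : Fin (n + 1) => (((j : ℕ) : ℂ) + 1) • G) fun j =>
      ⟨(0, 0, 1, 0), by simpa [G] using Nat.cast_add_one_ne_zero (R := ℂ) (j : ℕ)⟩
  obtain ⟨o3, d3⟩ := isOpen_dense_theta_comp_ne_zero hτ
    (fun p : {p : Fin N × Fin N // p.1 ≠ p.2} × Finset.Icc (-(n + 2) : ℤ) (n + 2) =>
      Λ p.1.1.1 - Λ p.1.1.2 + ((p.2 : ℤ) : ℂ) • G) fun p =>
      ⟨(0, 0, 0, Pi.single p.1.1.1 1), by simp [Λ, G, p.1.2.symm]⟩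
  refine ⟨_, (o1.inter o2).inter o3, (d1.inter_of_isOpen_left d2 o1).inter_of_isOpen_left d3
    (o1.inter o2), ?_⟩
  rintro z w γ lam ⟨⟨h1, h2⟩, h3⟩
  exact Lop_mul_idTensorShift_WS hτ h1 h2 fun i j hij k hk => h3 (⟨(i, j), hij⟩, ⟨k, hk⟩)

end EllipticQG
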